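/- Let 1 < p < ∞, q = p/(p-1), and for ξ ∈ 𝔻 define Υ_ξ(z) = ∑_{k=0}^∞ a_k(ξ)(z·conj(ξ))^k where a_k(ξ) = ((1)_k/k!)·(F(2/p-1, k+1; k+2; |ξ|²) - Γ(2/q)Γ(k+2)/Γ(k+1+2/q)). Then sup_{ξ∈𝔻} ∫_𝔻 |Υ_ξ(z)|^p dν(z) < ∞. -/

import Mathlib

open MeasureTheory Real Set ComplexConjugate

/-- Pochhammer symbol `(a)_n` for a real number `a`. -/
noncomputable def poch (a : ℝ) (n : ℕ) : ℝ := ∏ i ∈ Finset.range n, (a + i)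

/-- Gauss hypergeometric series `F(a,b;c;x)`. -/
noncomputable def hypF (a b c x : ℝ) : ℝ :=
  ∑' n : ℕ, poch a n * poch b n / (poch c n * n.factorial) * x ^ n

/-- The coefficients `a_k(ξ)` from Lemma 2.5. -/
noncomputable def aCoef (p q : ℝ) (ξ : ℂ) (k : ℕ) : ℝ :=
  poch 1 k / k.factorial *
    (hypF (2 / p - 1) (k + 1) (k + 2) (‖ξ‖ ^ 2) -
      Real.Gamma (2 / q) * Real.Gamma (k + 2) / Real.Gamma (k + 1 + 2 / q))

/-- The function `Υ_ξ`. -/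
noncomputable def UpsF (p q : ℝ) (ξ z : ℂ) : ℂ :=
  ∑' k : ℕ, ((aCoef p q ξ k : ℝ) : ℂ) * (z * conj ξ) ^ k

theorem poch_succ (a : ℝ) (n : ℕ) : poch a (n + 1) = poch a n * (a + n) := by
  simp [poch, Finset.prod_range_succ]

theorem poch_pos {a : ℝ} (ha : 0 < a) (n : ℕ) : 0 < poch a n :=
  Finset.prod_pos fun i _ => by positivity

theorem poch_eq_ascPochhammer_eval (a : ℝ) (n : ℕ) : poch a n = (ascPochhammer ℝ n).eval a := by
  induction n with
  | zero => simp [poch]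
  | succ n ih => rw [poch_succ, ascPochhammer_succ_eval, ih]

theorem poch_div_factorial (a : ℝ) (n : ℕ) :
    poch a n / n.factorial = Ring.choose (a + n - 1) n := by
  rw [← Ring.multichoose_eq, div_eq_iff (by positivity), poch_eq_ascPochhammer_eval, mul_comm,
    ← nsmul_eq_mul, Ring.factorial_nsmul_multichoose_eq_ascPochhammer,
    Polynomial.ascPochhammer_smeval_eq_eval]

theorem poch_one (k : ℕ) : poch 1 k = k.factorial := by
  rw [poch_eq_ascPochhammer_eval, ascPochhammer_eval_one]

/-- The binomial series `∑ (a)_n / n! y ^ n = (1 - y) ^ (-a)`. -/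
theorem hasSum_poch_div_factorial_mul_pow (a : ℝ) {y : ℝ} (hy : |y| < 1) :
    HasSum (fun n : ℕ => poch a n / n.factorial * y ^ n) ((1 - y) ^ (-a)) := by
  have h := (Real.one_div_one_sub_rpow_hasFPowerSeriesOnBall_zero a).hasSum (y := y)
    (by simpa [enorm_eq_nnnorm, ← NNReal.coe_lt_coe] using hy)
  have h1 : (0 : ℝ) ≤ 1 - y := by linarith [(abs_lt.mp hy).2]
  rw [zero_add, one_div, ← Real.rpow_neg h1] at h
  simpa [poch_div_factorial, FormalMultilinearSeries.ofScalars, mul_comm] using h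

theorem poch_div_poch_add_one {b : ℝ} (hb : 0 < b) (n : ℕ) :
    poch b n / poch (b + 1) n = b / (b + n) := by
  rw [div_eq_div_iff (poch_pos (by linarith) n).ne' (by positivity)]
  induction n with
  | zero => simp [poch]
  | succ n ih =>
    rw [poch_succ, poch_succ, ih]
    push_cast
    ring

/-- Euler's integral formula for `F(a, k + 1; k + 2; x)`. -/
theorem hypF_eq_integral (a : ℝ) (k : ℕ) {x : ℝ} (hx0 : 0 ≤ x) (hx1 : x < 1) :
    hypF a (k + 1) (k + 2) x =
      (k + 1) * ∫ t in Ioc (0 : ℝ) 1, t ^ k * (1 - x * t) ^ (-a) := by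
  have hint : ∀ n : ℕ, ∫ t in Ioc (0 : ℝ) 1, t ^ n = ((n : ℝ) + 1)⁻¹ := fun n => by
    rw [← intervalIntegral.integral_of_le zero_le_one]
    simp
  have hi : ∀ n : ℕ, IntegrableOn (fun t : ℝ => t ^ n) (Ioc 0 1) := fun n =>
    (continuous_pow n).integrableOn_Ioc
  have hsum := hasSum_integral_of_summable_integral_norm (μ := volume.restrict (Ioc (0 : ℝ) 1))
    (F := fun (n : ℕ) t => poch a n / n.factorial * x ^ n * t ^ (n + k))
    (fun n => (hi _).const_mul _) ?_
  · have hpt : ∀ t ∈ Ioc (0 : ℝ) 1,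
        ∑' n : ℕ, poch a n / n.factorial * x ^ n * t ^ (n + k) = t ^ k * (1 - x * t) ^ (-a) := by
      intro t ht
      have hxt : |x * t| < 1 := by
        rw [abs_of_nonneg (mul_nonneg hx0 ht.1.le)]
        nlinarith [ht.1, ht.2]
      rw [← (hasSum_poch_div_factorial_mul_pow a hxt).tsum_eq, ← tsum_mul_left]
      exact tsum_congr fun n => by rw [mul_pow, pow_add]; ring
    rw [← setIntegral_congr_fun measurableSet_Ioc hpt, ← hsum.tsum_eq, hypF, ← tsum_mul_left]
    refine tsum_congr fun n => ?_
    rw [integral_const_mul, hint]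
    have h := poch_div_poch_add_one (b := k + 1) (by positivity) n
    rw [show (k : ℝ) + 1 + 1 = k + 2 by ring] at h
    rw [show poch a n * poch (k + 1) n / (poch (k + 2) n * n.factorial) =
      poch a n / n.factorial * (poch (k + 1) n / poch (k + 2) n) by
        rw [div_mul_div_comm, mul_comm (poch (k + 2) n)], h]
    have h1 : (k : ℝ) + 1 + n ≠ 0 := by positivity
    have h2 : (n : ℝ) + k + 1 ≠ 0 := by positivity
    push_cast
    field_simp
    ring
  · have hs := (hasSum_poch_div_factorial_mul_pow a (y := x)
      (by rwa [abs_of_nonneg hx0])).summable.norm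
    refine hs.of_nonneg_of_le (fun n => integral_nonneg fun t => norm_nonneg _) fun n => ?_
    simp_rw [norm_mul _ (_ ^ (n + k))]
    rw [integral_const_mul]
    refine mul_le_of_le_one_right (norm_nonneg _) ?_
    rw [setIntegral_congr_fun (g := fun t : ℝ => t ^ (n + k)) measurableSet_Ioc, hint]
    · exact inv_le_one_of_one_le₀ (by linarith [(n + k).cast_nonneg (α := ℝ)])
    · intro t ht
      exact Real.norm_of_nonneg (pow_nonneg ht.1.le _)

theorem integrableOn_one_sub_rpow {c : ℝ} (hc : 0 < c) :
    IntegrableOn (fun t : ℝ => (1 - t) ^ (c - 1)) (Ioc 0 1) := by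
  rw [← intervalIntegrable_iff_integrableOn_Ioc_of_le zero_le_one]
  have h := (intervalIntegral.intervalIntegrable_rpow' (a := 0) (b := 1)
    (r := c - 1) (by linarith)).comp_sub_left 1
  simpa using h.symm

theorem integral_pow_mul_one_sub_rpow (k : ℕ) {c : ℝ} (hc : 0 < c) :
    ∫ t in Ioc (0 : ℝ) 1, t ^ k * (1 - t) ^ (c - 1) =
      Real.Gamma (k + 1) * Real.Gamma c / Real.Gamma (k + 1 + c) := by
  have h := ProbabilityTheory.beta_eq_betaIntegralReal (k + 1) c (by positivity) hc
  rw [ProbabilityTheory.beta] at h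
  rw [h, Complex.betaIntegral, intervalIntegral.integral_of_le zero_le_one]
  rw [← Complex.ofReal_re (∫ t in Ioc (0 : ℝ) 1, t ^ k * (1 - t) ^ (c - 1)), ← integral_complex_ofReal]
  congr 1
  refine setIntegral_congr_fun measurableSet_Ioc fun t ht => ?_
  have h1 : 0 ≤ 1 - t := by linarith [ht.2]
  push_cast [Complex.ofReal_cpow h1]
  rw [add_sub_cancel_right, Complex.cpow_natCast]

theorem integrableOn_rpow_sub_rpow {b x : ℝ} (hb : 0 < b) (hx0 : 0 ≤ x) (hx1 : x < 1) :
    IntegrableOn (fun t : ℝ => (1 - x * t) ^ (b - 1) - (1 - t) ^ (b - 1)) (Ioc 0 1) := by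
  refine Integrable.sub ?_ (integrableOn_one_sub_rpow hb)
  refine IntegrableOn.mono_set (ContinuousOn.integrableOn_Icc ?_) Ioc_subset_Icc_self
  refine ContinuousOn.rpow_const (by fun_prop) fun t ht => Or.inl ?_
  nlinarith [ht.1, ht.2]

theorem aCoef_eq_integral {p q : ℝ} (hp1 : 1 < p) (hq : q = p / (p - 1)) {ξ : ℂ} (hξ : ‖ξ‖ < 1)
    (k : ℕ) :
    aCoef p q ξ k = (k + 1) * ∫ t in Ioc (0 : ℝ) 1,
      t ^ k * ((1 - ‖ξ‖ ^ 2 * t) ^ (2 / q - 1) - (1 - t) ^ (2 / q - 1)) := by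
  have hp0 : p - 1 ≠ 0 := by linarith
  have hp : p ≠ 0 := by linarith
  have hexp : -(2 / p - 1) = 2 / q - 1 := by
    rw [hq]
    field_simp
    ring
  have hb : 0 < 2 / q := by
    rw [hq]
    have : 0 < p - 1 := by linarith
    positivity
  have hx0 : 0 ≤ ‖ξ‖ ^ 2 := by positivity
  have hx1 : ‖ξ‖ ^ 2 < 1 := pow_lt_one₀ (norm_nonneg _) hξ two_ne_zero
  have hi2 : IntegrableOn (fun t : ℝ => t ^ k * (1 - t) ^ (2 / q - 1)) (Ioc 0 1) := by
    refine (integrableOn_one_sub_rpow hb).bdd_mul (c := 1)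
      (continuous_pow k).aestronglyMeasurable ?_
    filter_upwards [ae_restrict_mem measurableSet_Ioc] with t ht
    rw [Real.norm_of_nonneg (pow_nonneg ht.1.le _)]
    exact pow_le_one₀ ht.1.le ht.2
  have hi1 : IntegrableOn (fun t : ℝ => t ^ k * (1 - ‖ξ‖ ^ 2 * t) ^ (2 / q - 1)) (Ioc 0 1) := by
    refine IntegrableOn.mono_set (ContinuousOn.integrableOn_Icc ?_) Ioc_subset_Icc_self
    refine ContinuousOn.mul (by fun_prop) (ContinuousOn.rpow_const (by fun_prop) fun t ht =>
      Or.inl ?_)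
    nlinarith [ht.1, ht.2]
  simp_rw [mul_sub]
  rw [integral_sub hi1 hi2, integral_pow_mul_one_sub_rpow k hb, aCoef,
    hypF_eq_integral _ _ hx0 hx1, hexp, poch_one, div_self (by positivity), one_mul,
    show (k : ℝ) + 2 = k + 1 + 1 by ring, Real.Gamma_add_one (s := (k : ℝ) + 1) (by positivity)]
  ring

theorem UpsF_eq_integral {p q : ℝ} (hp1 : 1 < p) (hq : q = p / (p - 1)) {ξ z : ℂ} (hξ : ‖ξ‖ < 1)
    (hz : ‖z‖ < 1) :
    UpsF p q ξ z = ∫ t in Ioc (0 : ℝ) 1,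
      (((1 - ‖ξ‖ ^ 2 * t) ^ (2 / q - 1) - (1 - t) ^ (2 / q - 1) : ℝ) : ℂ) *
        (1 / (1 - t * (z * conj ξ)) ^ 2) := by
  have hb : 0 < 2 / q := by
    rw [hq]
    have : 0 < p - 1 := by linarith
    positivity
  have hw : ‖z * conj ξ‖ < 1 := by
    rw [norm_mul, RCLike.norm_conj]
    nlinarith [norm_nonneg z, norm_nonneg ξ]
  set w := z * conj ξ with hwdef
  set D : ℝ → ℝ := fun t => (1 - ‖ξ‖ ^ 2 * t) ^ (2 / q - 1) - (1 - t) ^ (2 / q - 1) with hD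
  have hDi : IntegrableOn D (Ioc 0 1) := integrableOn_rpow_sub_rpow hb (by positivity)
    (pow_lt_one₀ (norm_nonneg _) hξ two_ne_zero)
  have hFi : ∀ k : ℕ, IntegrableOn (fun t : ℝ => t ^ k * D t) (Ioc 0 1) := fun k => by
    refine hDi.bdd_mul (c := 1) (continuous_pow k).aestronglyMeasurable ?_
    filter_upwards [ae_restrict_mem measurableSet_Ioc] with t ht
    rw [Real.norm_of_nonneg (pow_nonneg ht.1.le _)]
    exact pow_le_one₀ ht.1.le ht.2
  have hgeom : ∀ u : ℂ, ‖u‖ < 1 →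
      HasSum (fun k : ℕ => ((k : ℂ) + 1) * u ^ k) (1 / (1 - u) ^ 2) := fun u hu => by
    simpa using hasSum_choose_mul_geometric_of_norm_lt_one 1 hu
  have hgeomr : Summable (fun k : ℕ => ((k : ℝ) + 1) * ‖w‖ ^ k) := by
    simpa using summable_choose_mul_geometric_of_norm_lt_one 1 (r := ‖w‖) (by simpa using hw)
  have hsum := hasSum_integral_of_summable_integral_norm (μ := volume.restrict (Ioc (0 : ℝ) 1))
    (F := fun (k : ℕ) t => ((k : ℂ) + 1) * w ^ k * ((t ^ k * D t : ℝ) : ℂ))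
    (fun k => ((hFi k).ofReal (𝕜 := ℂ)).const_mul _) ?_
  · have hpt : ∀ t ∈ Ioc (0 : ℝ) 1,
        ∑' k : ℕ, ((k : ℂ) + 1) * w ^ k * ((t ^ k * D t : ℝ) : ℂ) =
          (D t : ℂ) * (1 / (1 - t * w) ^ 2) := by
      intro t ht
      have htw : ‖(t : ℂ) * w‖ < 1 := by
        rw [norm_mul, Complex.norm_real, Real.norm_of_nonneg ht.1.le]
        nlinarith [ht.1, ht.2, norm_nonneg w]
      rw [← (hgeom _ htw).tsum_eq, ← tsum_mul_left]
      refine tsum_congr fun k => ?_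
      push_cast
      ring
    rw [← setIntegral_congr_fun measurableSet_Ioc hpt, ← hsum.tsum_eq, UpsF]
    refine tsum_congr fun k => ?_
    rw [integral_const_mul, integral_complex_ofReal, aCoef_eq_integral hp1 hq hξ]
    push_cast
    ring
  · refine (hgeomr.mul_right (∫ t in Ioc (0 : ℝ) 1, ‖D t‖)).of_nonneg_of_le
      (fun k => integral_nonneg fun t => norm_nonneg _) fun k => ?_
    rw [← integral_const_mul]
    refine setIntegral_mono_on ((hFi k).ofReal (𝕜 := ℂ) |>.const_mul _).norm
      (hDi.norm.const_mul _) measurableSet_Ioc fun t ht => ?_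
    have hk : ‖(k : ℂ) + 1‖ = k + 1 := by
      rw [← Nat.cast_add_one, Complex.norm_natCast]
      push_cast
      rfl
    rw [norm_mul, norm_mul ((k : ℂ) + 1), hk, norm_pow, Complex.norm_real, norm_mul (t ^ k),
      Real.norm_of_nonneg (pow_nonneg ht.1.le _)]
    gcongr
    exact mul_le_of_le_one_left (norm_nonneg _) (pow_le_one₀ ht.1.le ht.2)

theorem abs_one_add_rpow_sub_one_le {b h : ℝ} (hb0 : 0 < b) (hb2 : b < 2) (hh : 0 ≤ h) :
    |(1 + h) ^ (b - 1) - 1| ≤ h ^ (b / 2) := by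
  have h1 : 1 ≤ 1 + h := by linarith
  have hpos : 0 < 1 + h := by linarith
  have hsmall : h ≤ 1 → h ≤ h ^ (b / 2) := fun hle =>
    Real.self_le_rpow_of_le_one hh hle (by linarith)
  rcases le_total b 1 with hb | hb
  · have hle1 : (1 + h) ^ (b - 1) ≤ 1 := Real.rpow_le_one_of_one_le_of_nonpos h1 (by linarith)
    have hnn : 0 ≤ (1 + h) ^ (b - 1) := by positivity
    rw [abs_of_nonpos (by linarith)]
    rcases le_total h 1 with hh1 | hh1
    · have h2 : (1 + h) ^ (-1 : ℝ) ≤ (1 + h) ^ (b - 1) :=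
        Real.rpow_le_rpow_of_exponent_le h1 (by linarith)
      have h3 : 1 - h ≤ (1 + h) ^ (-1 : ℝ) := by
        rw [Real.rpow_neg_one, ← one_div, le_div_iff₀ hpos]
        nlinarith
      linarith [hsmall hh1]
    · linarith [Real.one_le_rpow hh1 (by linarith : (0 : ℝ) ≤ b / 2)]
  · rw [abs_of_nonneg (by linarith [Real.one_le_rpow h1 (by linarith : 0 ≤ b - 1)])]
    rcases le_total h 1 with hh1 | hh1
    · have h2 : (1 + h) ^ (b - 1) ≤ (1 + h) ^ (1 : ℝ) :=
        Real.rpow_le_rpow_of_exponent_le h1 (by linarith)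
      rw [Real.rpow_one] at h2
      linarith [hsmall hh1]
    · have h2 := Real.rpow_add_le_add_rpow zero_le_one hh (by linarith : 0 ≤ b - 1)
        (by linarith)
      rw [Real.one_rpow] at h2
      linarith [Real.rpow_le_rpow_of_exponent_le hh1 (by linarith : b - 1 ≤ b / 2)]

theorem abs_add_rpow_sub_rpow_le {b u h : ℝ} (hb0 : 0 < b) (hb2 : b < 2) (hu : 0 < u)
    (hh : 0 ≤ h) : |(u + h) ^ (b - 1) - u ^ (b - 1)| ≤ h ^ (b / 2) * u ^ (b / 2 - 1) := by
  have h1 := abs_one_add_rpow_sub_one_le hb0 hb2 (div_nonneg hh hu.le)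
  have h2 : (u + h) ^ (b - 1) - u ^ (b - 1) = u ^ (b - 1) * ((1 + h / u) ^ (b - 1) - 1) := by
    rw [mul_sub, ← Real.mul_rpow hu.le (by positivity), mul_one, mul_add, mul_one,
      mul_div_cancel₀ _ hu.ne']
  have h3 : h ^ (b / 2) * u ^ (b / 2 - 1) = u ^ (b - 1) * (h / u) ^ (b / 2) := by
    rw [Real.div_rpow hh hu.le, show b - 1 = (b / 2 - 1) + b / 2 by ring, Real.rpow_add hu]
    field_simp
  rw [h2, h3, abs_mul, abs_of_nonneg (Real.rpow_nonneg hu.le _)]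
  gcongr

theorem one_sub_le_norm_one_sub_mul {w : ℂ} (hw : ‖w‖ ≤ 1) {t : ℝ} (ht : 0 ≤ t) :
    1 - t ≤ ‖1 - t * w‖ := by
  have h := norm_sub_norm_le (1 : ℂ) (t * w)
  rw [norm_one, norm_mul, Complex.norm_real, Real.norm_of_nonneg ht] at h
  nlinarith

theorem norm_one_sub_div_two_le {w : ℂ} (hw : ‖w‖ ≤ 1) {t : ℝ} (ht0 : 0 ≤ t) (ht1 : t ≤ 1) :
    ‖1 - w‖ / 2 ≤ ‖1 - t * w‖ := by
  have h := norm_add_le (1 - t * w) (-((1 - t : ℝ) : ℂ) * w)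
  rw [show 1 - t * w + -((1 - t : ℝ) : ℂ) * w = 1 - w by push_cast; ring, norm_mul, norm_neg,
    Complex.norm_real, Real.norm_of_nonneg (by linarith)] at h
  nlinarith [one_sub_le_norm_one_sub_mul hw ht0]

theorem norm_UpsF_le {p q : ℝ} (hp1 : 1 < p) (hq : q = p / (p - 1)) {ξ z : ℂ} (hξ : ‖ξ‖ < 1)
    (hz : ‖z‖ < 1) :
    ‖UpsF p q ξ z‖ ≤ (1 - ‖ξ‖ ^ 2) ^ (1 / q) *
      ((1 / (1 / q) + 1 / (2 - 1 / q)) * (‖1 - z * conj ξ‖ / 2) ^ (1 / q - 2)) := by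
  obtain ⟨c, hc⟩ : ∃ c, c = 1 / q := ⟨_, rfl⟩
  have hp0 : 0 < p - 1 := by linarith
  have hcp : c = 1 - 1 / p := by
    rw [hc, hq]
    field_simp
  have hc0 : 0 < c := by
    rw [hc, hq]
    positivity
  have hc1 : c < 1 := by
    have : 0 < 1 / p := by positivity
    linarith
  have hb : 2 / q = 2 * c := by rw [hc]; ring
  rw [UpsF_eq_integral hp1 hq hξ hz, hb, ← hc]
  have hw : ‖z * conj ξ‖ < 1 := by
    rw [norm_mul, RCLike.norm_conj]
    nlinarith [norm_nonneg z, norm_nonneg ξ]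
  set w := z * conj ξ with hwdef
  have hx0 : 0 ≤ ‖ξ‖ ^ 2 := by positivity
  have hx1 : ‖ξ‖ ^ 2 < 1 := pow_lt_one₀ (norm_nonneg _) hξ two_ne_zero
  set x := ‖ξ‖ ^ 2 with hx
  set R := ‖1 - w‖ / 2 with hR
  have hw1 : 0 < 1 - ‖w‖ := by linarith
  have hR0 : 0 < R := by
    have := norm_sub_norm_le 1 w
    rw [norm_one] at this
    rw [hR]
    linarith
  have hR1 : R ≤ 1 := by
    have := norm_sub_le 1 w
    rw [norm_one] at this
    rw [hR]
    linarith
  set G : ℝ → ℂ := fun t => (((1 - x * t) ^ (2 * c - 1) - (1 - t) ^ (2 * c - 1) : ℝ) : ℂ) *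
    (1 / (1 - t * w) ^ 2) with hG
  have hne : ∀ t : ℝ, 0 ≤ t → t ≤ 1 → 0 < ‖1 - t * w‖ := fun t ht0 ht1 =>
    hR0.trans_le (norm_one_sub_div_two_le hw.le ht0 ht1)
  have hGi : IntervalIntegrable G volume 0 1 := by
    refine IntervalIntegrable.mul_continuousOn ?_ ?_
    · rw [intervalIntegrable_iff_integrableOn_Ioc_of_le zero_le_one]
      exact (integrableOn_rpow_sub_rpow (by linarith) hx0 hx1).ofReal (𝕜 := ℂ)
    · rw [uIcc_of_le zero_le_one]
      refine ContinuousOn.div (by fun_prop) (by fun_prop) fun t ht => pow_ne_zero 2 ?_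
      exact norm_pos_iff.mp (hne t ht.1 ht.2)
  have hnorm : ∀ t : ℝ, 0 < t → t < 1 →
      ‖G t‖ ≤ (1 - x) ^ c * (1 - t) ^ (c - 1) * (1 / ‖1 - t * w‖ ^ 2) := by
    intro t ht0 ht1
    have hu : 0 < 1 - t := by linarith
    have h1 := abs_add_rpow_sub_rpow_le (b := 2 * c) (u := 1 - t) (h := t * (1 - x))
      (by linarith) (by linarith) hu (by nlinarith)
    rw [show 1 - t + t * (1 - x) = 1 - x * t by ring, show 2 * c / 2 = c by ring] at h1
    have h2 : (t * (1 - x)) ^ c ≤ (1 - x) ^ c :=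
      Real.rpow_le_rpow (by nlinarith) (by nlinarith) hc0.le
    rw [hG, norm_mul, Complex.norm_real, norm_div, norm_one, norm_pow, Real.norm_eq_abs]
    gcongr
    exact h1.trans (by gcongr)
  have hnear : ‖∫ t in (1 - R)..1, G t‖ ≤ (1 - x) ^ c * (1 / c * R ^ (c - 2)) := by
    have hle : ‖∫ t in (1 - R)..1, G t‖ ≤
        ∫ t in (1 - R)..1, (1 - x) ^ c * (R ^ (-2 : ℝ) * (1 - t) ^ (c - 1)) := by
      refine intervalIntegral.norm_integral_le_of_norm_le (by linarith) ?_ ?_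
      · filter_upwards [compl_mem_ae_iff.mpr (measure_singleton (1 : ℝ))] with t ht1 ht
        have ht1 : t < 1 := lt_of_le_of_ne ht.2 ht1
        have ht0 : 0 < t := by linarith [ht.1]
        refine (hnorm t ht0 ht1).trans ?_
        have hu : 0 < 1 - t := by linarith
        rw [mul_assoc, mul_comm (R ^ (-2 : ℝ)), Real.rpow_neg hR0.le, Real.rpow_two, ← one_div]
        have := norm_one_sub_div_two_le hw.le ht0.le ht1.le
        gcongr
      · have h := (intervalIntegral.intervalIntegrable_rpow' (a := R) (b := 0)
          (r := c - 1) (by linarith)).comp_sub_left 1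
        simp only [sub_zero] at h
        exact (h.const_mul _).const_mul _
    refine hle.trans (le_of_eq ?_)
    rw [intervalIntegral.integral_const_mul, intervalIntegral.integral_const_mul,
      intervalIntegral.integral_comp_sub_left (fun s => s ^ (c - 1)), sub_self, sub_sub_cancel,
      integral_rpow (Or.inl (by linarith)), sub_add_cancel, Real.zero_rpow hc0.ne', sub_zero,
      show c - 2 = -2 + c by ring, Real.rpow_add hR0]
    ring
  have hfar : ‖∫ t in (0 : ℝ)..(1 - R), G t‖ ≤ (1 - x) ^ c * (1 / (2 - c) * R ^ (c - 2)) := by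
    have hle : ‖∫ t in (0 : ℝ)..(1 - R), G t‖ ≤
        ∫ t in (0 : ℝ)..(1 - R), (1 - x) ^ c * (1 - t) ^ (c - 3) := by
      refine intervalIntegral.norm_integral_le_of_norm_le (by linarith) ?_ ?_
      · refine ae_of_all _ fun t ht => ?_
        have ht1 : t < 1 := by linarith [ht.2]
        refine (hnorm t ht.1 ht1).trans ?_
        have hu : 0 < 1 - t := by linarith
        have h3 : (1 - t) ^ (c - 3) = (1 - t) ^ (c - 1) * (1 / (1 - t) ^ 2) := by
          rw [show c - 3 = c - 1 + -2 by ring, Real.rpow_add hu, Real.rpow_neg hu.le,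
            Real.rpow_two, one_div]
        rw [mul_assoc, h3]
        have := one_sub_le_norm_one_sub_mul hw.le ht.1.le
        gcongr
      · refine ContinuousOn.intervalIntegrable (ContinuousOn.mul (by fun_prop)
          (ContinuousOn.rpow_const (by fun_prop) fun t ht => Or.inl ?_))
        rw [uIcc_of_le (by linarith)] at ht
        linarith [ht.2]
    refine hle.trans ?_
    rw [intervalIntegral.integral_const_mul,
      intervalIntegral.integral_comp_sub_left (fun s => s ^ (c - 3)), sub_zero, sub_sub_cancel,
      integral_rpow (Or.inr ⟨by linarith, by
        rw [uIcc_of_le hR1]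
        exact fun h => by linarith [h.1]⟩), Real.one_rpow, show c - 3 + 1 = -(2 - c) by ring,
      show c - 2 = -(2 - c) by ring]
    have h2c : 0 < 2 - c := by linarith
    have : 0 ≤ (1 - x) ^ c := Real.rpow_nonneg (by linarith) _
    gcongr
    rw [div_neg, ← neg_div, neg_sub, one_div, ← div_eq_inv_mul]
    gcongr
    linarith
  rw [← intervalIntegral.integral_of_le zero_le_one,
    ← intervalIntegral.integral_add_adjacent_intervals (b := 1 - R)
      (hGi.mono_set ?_) (hGi.mono_set ?_)]
  · refine (norm_add_le _ _).trans ((add_le_add hfar hnear).trans (le_of_eq ?_))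
    ring
  · rw [uIcc_of_le (by linarith), uIcc_of_le zero_le_one]
    exact Icc_subset_Icc_right (by linarith)
  · rw [uIcc_of_le (by linarith), uIcc_of_le zero_le_one]
    exact Icc_subset_Icc_left (by linarith)

/-- On the unit disc, `‖1 - z * conj ξ‖` dominates `δ + ‖z - a‖` for a suitable centre `a`,
where `δ = 1 - ‖ξ‖ ^ 2`. -/
theorem exists_le_norm_one_sub_mul_conj {ξ : ℂ} (hξ : ‖ξ‖ < 1) :
    ∃ a : ℂ, ∀ z : ℂ, ‖z‖ < 1 →
      (1 - ‖ξ‖ ^ 2) / 4 * (1 + ‖(1 - ‖ξ‖ ^ 2)⁻¹ • (z - a)‖) ≤ ‖1 - z * conj ξ‖ := by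
  have hδ : 0 < 1 - ‖ξ‖ ^ 2 := by nlinarith [norm_nonneg ξ]
  have hlow : ∀ z : ℂ, ‖z‖ < 1 → 1 - ‖ξ‖ ≤ ‖1 - z * conj ξ‖ := fun z hz => by
    have h := norm_sub_norm_le 1 (z * conj ξ)
    rw [norm_one, norm_mul, RCLike.norm_conj] at h
    nlinarith [norm_nonneg ξ, norm_nonneg z]
  have hscale : ∀ u : ℂ, (1 - ‖ξ‖ ^ 2) / 4 * (1 + ‖(1 - ‖ξ‖ ^ 2)⁻¹ • u‖) =
      ((1 - ‖ξ‖ ^ 2) + ‖u‖) / 4 := fun u => by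
    rw [norm_smul, Real.norm_of_nonneg (inv_nonneg.mpr hδ.le)]
    field_simp
  simp_rw [hscale]
  rcases lt_or_ge ‖ξ‖ (1 / 2) with hlt | hge
  · refine ⟨0, fun z hz => ?_⟩
    rw [sub_zero]
    nlinarith [hlow z hz, norm_nonneg ξ]
  · have hξ0 : conj ξ ≠ 0 := by
      rw [← norm_pos_iff, RCLike.norm_conj]
      linarith
    refine ⟨(conj ξ)⁻¹, fun z hz => ?_⟩
    have h1 : ‖1 - z * conj ξ‖ = ‖z - (conj ξ)⁻¹‖ * ‖ξ‖ := by
      rw [← RCLike.norm_conj ξ, ← norm_mul, sub_mul, inv_mul_cancel₀ hξ0, norm_sub_rev]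
    have h2 : ‖z - (conj ξ)⁻¹‖ / 2 ≤ ‖1 - z * conj ξ‖ := by
      rw [h1]
      nlinarith [norm_nonneg (z - (conj ξ)⁻¹)]
    nlinarith [hlow z hz, norm_nonneg ξ]

/-- Lemma 2.5 (second part): `sup_{ξ∈𝔻} ∫_𝔻 |Υ_ξ|^p dν < ∞`. -/
theorem sup_Ups_finite (p q : ℝ) (hp1 : 1 < p) (hq : q = p / (p - 1)) :
    ∃ M : ℝ, ∀ ξ : ℂ, ‖ξ‖ < 1 →
      (∫ z in Metric.ball (0:ℂ) 1, ‖UpsF p q ξ z‖ ^ p) / π ≤ M := by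
  obtain ⟨c, hc⟩ : ∃ c, c = 1 / q := ⟨_, rfl⟩
  have hp0 : 0 < p - 1 := by linarith
  have hcp : c = 1 - 1 / p := by
    rw [hc, hq]
    field_simp
  have hc0 : 0 < c := by
    rw [hc, hq]
    positivity
  have hc1 : c < 1 := by
    have : 0 < 1 / p := by positivity
    linarith
  set K : ℝ := 1 / c + 1 / (2 - c) with hK
  have hK0 : 0 ≤ K := by
    have : 0 < 2 - c := by linarith
    positivity
  set A : ℝ := (K * (1 / 8) ^ (c - 2)) ^ p with hA
  set g : ℂ → ℝ := fun u => (1 + ‖u‖) ^ (-(p + 1)) with hg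
  have hgi : Integrable g := integrable_one_add_norm (by
    rw [Complex.finrank_real_complex]
    push_cast
    linarith)
  have hg0 : ∀ u, 0 ≤ g u := fun u => by positivity
  refine ⟨A * (∫ u, g u) / π, fun ξ hξ => ?_⟩
  gcongr
  have hδ : 0 < 1 - ‖ξ‖ ^ 2 := by nlinarith [norm_nonneg ξ]
  obtain ⟨a, ha⟩ := exists_le_norm_one_sub_mul_conj hξ
  set δ := 1 - ‖ξ‖ ^ 2 with hδdef
  have hpt : ∀ z ∈ Metric.ball (0 : ℂ) 1,
      ‖UpsF p q ξ z‖ ^ p ≤ A * ((δ ^ 2)⁻¹ * g (δ⁻¹ • (z - a))) := by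
    intro z hz
    have hz : ‖z‖ < 1 := by simpa using hz
    have h1 := norm_UpsF_le hp1 hq hξ hz
    rw [← hc, ← hδdef, ← hK] at h1
    set N := 1 + ‖δ⁻¹ • (z - a)‖ with hN
    have hN0 : 0 < N := by positivity
    have h2 : (‖1 - z * conj ξ‖ / 2) ^ (c - 2) ≤ (1 / 8 * δ * N) ^ (c - 2) :=
      Real.rpow_le_rpow_of_nonpos (by positivity) (by linarith [ha z hz]) (by linarith)
    have h3 : ‖UpsF p q ξ z‖ ≤ K * (1 / 8) ^ (c - 2) * δ ^ (2 * c - 2) * N ^ (c - 2) := by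
      refine h1.trans ((mul_le_mul_of_nonneg_left (mul_le_mul_of_nonneg_left h2 hK0)
        (Real.rpow_nonneg hδ.le _)).trans (le_of_eq ?_))
      rw [Real.mul_rpow (by positivity) hN0.le, Real.mul_rpow (by norm_num) hδ.le,
        show 2 * c - 2 = c + (c - 2) by ring, Real.rpow_add hδ]
      ring
    refine (Real.rpow_le_rpow (norm_nonneg _) h3 (by linarith)).trans (le_of_eq ?_)
    have e1 : (2 * c - 2) * p = -2 := by
      rw [hcp]
      field_simp
      ring
    have e2 : (c - 2) * p = -(p + 1) := by
      rw [hcp]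
      field_simp
      ring
    rw [Real.mul_rpow (by positivity) (by positivity), Real.mul_rpow (by positivity)
      (by positivity), ← Real.rpow_mul hδ.le, ← Real.rpow_mul hN0.le, e1, e2,
      Real.rpow_neg hδ.le, Real.rpow_two, mul_assoc]
  have hgc : Integrable fun z => A * ((δ ^ 2)⁻¹ * g (δ⁻¹ • (z - a))) :=
    (((hgi.comp_smul (inv_ne_zero hδ.ne')).comp_sub_right a).const_mul _).const_mul _
  have hA0 : 0 ≤ A := by positivity
  calc ∫ z in Metric.ball (0 : ℂ) 1, ‖UpsF p q ξ z‖ ^ p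
      ≤ ∫ z in Metric.ball (0 : ℂ) 1, A * ((δ ^ 2)⁻¹ * g (δ⁻¹ • (z - a))) := by
        refine integral_mono_of_nonneg (ae_of_all _ fun z => by positivity) hgc.integrableOn ?_
        filter_upwards [ae_restrict_mem measurableSet_ball] with z hz using hpt z hz
    _ ≤ ∫ z, A * ((δ ^ 2)⁻¹ * g (δ⁻¹ • (z - a))) :=
        setIntegral_le_integral hgc (ae_of_all _ fun z =>
          mul_nonneg hA0 (mul_nonneg (by positivity) (hg0 _)))
    _ = A * ∫ u, g u := by
        rw [integral_const_mul, integral_const_mul,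
          integral_sub_right_eq_self (fun z => g (δ⁻¹ • z)),
          Measure.integral_comp_inv_smul_of_nonneg _ _ hδ.le, Complex.finrank_real_complex,
          smul_eq_mul, inv_mul_cancel_left₀ (by positivity)]
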